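/- For fixed ω₀ > 0, the vacuum photon-number expectation N(σ) = ∫₀^∞ |f_g(−ω)|² dω = (2π)^(−1/2)·(1/(ω₀σ)) · ∫₀^∞ ω · exp(−(ω+ω₀)²/(2σ²)) dω tends to 0 as σ → 0⁺. (In the limit of a long, many-cycle pulse the Gaussian mode contains no virtual particles.) -/

import Mathlib

open MeasureTheory Real Filter

/-- Squared modulus `|f_g(ω)|²` of the spectral amplitude of the subcycle Gaussian mode:
`|f_g(ω)|² = (2π)^(−1/2) · (|ω|/(ω₀σ)) · exp(−(ω−ω₀)²/(2σ²))`. -/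
noncomputable def fgSq (σ ω₀ ω : ℝ) : ℝ :=
  (1 / Real.sqrt (2 * Real.pi)) * (|ω| / (ω₀ * σ)) * Real.exp (-(ω - ω₀) ^ 2 / (2 * σ ^ 2))

lemma integral_Ioi_mul_exp_neg_mul_sq {b : ℝ} (hb : 0 < b) :
    ∫ x in Set.Ioi (0 : ℝ), x * Real.exp (-b * x ^ 2) = (2 * b)⁻¹ := by
  have h := integral_rpow_mul_exp_neg_mul_rpow (p := 2) (q := 1) two_pos (by norm_num) hb
  norm_num [Real.rpow_neg_one] at h
  rw [mul_inv, mul_comm, ← one_div 2, ← h]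
  simp only [neg_mul]

lemma fgSq_neg_le {σ ω₀ ω : ℝ} (hσ : 0 < σ) (hω₀ : 0 < ω₀) (hω : 0 < ω) :
    fgSq σ ω₀ (-ω) ≤ (1 / Real.sqrt (2 * Real.pi) / (ω₀ * σ)) *
      (ω * Real.exp (-(2 * σ ^ 2)⁻¹ * ω ^ 2)) := by
  have hexp : Real.exp (-(-ω - ω₀) ^ 2 / (2 * σ ^ 2)) ≤ Real.exp (-(2 * σ ^ 2)⁻¹ * ω ^ 2) := by
    rw [neg_mul, inv_mul_eq_div, ← neg_div]
    refine Real.exp_le_exp.mpr (div_le_div_of_nonneg_right ?_ (by positivity))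
    nlinarith [mul_pos hω hω₀]
  calc fgSq σ ω₀ (-ω)
      = (1 / Real.sqrt (2 * Real.pi) / (ω₀ * σ)) *
          (ω * Real.exp (-(-ω - ω₀) ^ 2 / (2 * σ ^ 2))) := by
        rw [fgSq, abs_neg, abs_of_pos hω]
        ring
    _ ≤ _ := by gcongr

lemma fgSq_nonneg {σ ω₀ : ℝ} (hσ : 0 < σ) (hω₀ : 0 < ω₀) (ω : ℝ) : 0 ≤ fgSq σ ω₀ ω := by
  unfold fgSq
  positivity

lemma integral_Ioi_fgSq_neg_le {σ ω₀ : ℝ} (hσ : 0 < σ) (hω₀ : 0 < ω₀) :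
    ∫ ω in Set.Ioi (0 : ℝ), fgSq σ ω₀ (-ω) ≤ 1 / Real.sqrt (2 * Real.pi) / ω₀ * σ := by
  calc ∫ ω in Set.Ioi (0 : ℝ), fgSq σ ω₀ (-ω)
      ≤ ∫ ω in Set.Ioi (0 : ℝ), (1 / Real.sqrt (2 * Real.pi) / (ω₀ * σ)) *
          (ω * Real.exp (-(2 * σ ^ 2)⁻¹ * ω ^ 2)) := by
        refine integral_mono_of_nonneg (ae_of_all _ fun ω => fgSq_nonneg hσ hω₀ (-ω)) ?_ ?_
        · exact ((integrable_mul_exp_neg_mul_sq (by positivity)).integrableOn).const_mul _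
        · filter_upwards [ae_restrict_mem measurableSet_Ioi] with ω hω
          exact fgSq_neg_le hσ hω₀ hω
    _ = 1 / Real.sqrt (2 * Real.pi) / ω₀ * σ := by
        rw [integral_const_mul, integral_Ioi_mul_exp_neg_mul_sq (by positivity)]
        field_simp

/-- For fixed `ω₀ > 0`, the vacuum photon-number expectation
`N(σ) = ∫₀^∞ |f_g(−ω)|² dω` tends to `0` as `σ → 0⁺`: in the limit of a long,
many-cycle pulse the Gaussian mode contains no virtual particles. -/
theorem gaussian_mode_virtual_particles_vanish (ω₀ : ℝ) (hω₀ : 0 < ω₀) :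
    Tendsto (fun σ : ℝ => ∫ ω in Set.Ioi (0 : ℝ), fgSq σ ω₀ (-ω))
      (nhdsWithin 0 (Set.Ioi 0)) (nhds 0) := by
  have hlim : Tendsto (fun σ : ℝ => 1 / Real.sqrt (2 * Real.pi) / ω₀ * σ)
      (nhdsWithin 0 (Set.Ioi 0)) (nhds 0) :=
    ((continuous_const_mul _).tendsto' 0 0 (mul_zero _)).mono_left nhdsWithin_le_nhds
  refine squeeze_zero' ?_ ?_ hlim
  · filter_upwards [self_mem_nhdsWithin] with σ hσ
    exact integral_nonneg fun ω => fgSq_nonneg hσ hω₀ (-ω)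
  · filter_upwards [self_mem_nhdsWithin] with σ hσ
    exact integral_Ioi_fgSq_neg_le hσ hω₀
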